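/- arXiv:0904.3210 — 2 statements merged into one kernel-verified Lean document; each statement's English description precedes it below -/
import Mathlib

section
/- For the effective L-trader hamiltonian H, the total number operator N̂ = Σ_{l=1}^L a_l†a_l, the total cash operator K̂ = Σ_{l=1}^L c_l†c_l, and the operator Γ̂ = o†o + p†p are integrals of motion: [H, N̂] = [H, K̂] = [H, Γ̂] = 0 as linear operators, where [A,B] = AB − BA. -/
/- Context: the effective L-trader stock market. V is the free complex vector
space on basis vectors indexed by tuples (n_1,…,n_L; k_1,…,k_L; O; m) of
natural numbers, realized as finitely supported functions
((Fin L → ℕ) × (Fin L → ℕ) × ℕ × ℕ) →₀ ℂ. -/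

noncomputable section

/-- The index type of the basis: share numbers, cash numbers, supply, price. -/
abbrev Idx (L : ℕ) := (Fin L → ℕ) × (Fin L → ℕ) × ℕ × ℕ

abbrev W (L : ℕ) := Idx L →₀ ℂ

/-- The share annihilation operator a_l. -/
def aOp (L : ℕ) (l : Fin L) : Module.End ℂ (W L) :=
  Finsupp.lift _ ℂ (Idx L) fun i =>
    Finsupp.single (Function.update i.1 l (i.1 l - 1), i.2.1, i.2.2.1, i.2.2.2)
      ((Real.sqrt (i.1 l) : ℝ) : ℂ)

/-- The share creation operator a_l†. -/
def adagOp (L : ℕ) (l : Fin L) : Module.End ℂ (W L) :=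
  Finsupp.lift _ ℂ (Idx L) fun i =>
    Finsupp.single (Function.update i.1 l (i.1 l + 1), i.2.1, i.2.2.1, i.2.2.2)
      ((Real.sqrt (i.1 l + 1) : ℝ) : ℂ)

/-- The cash annihilation operator c_l. -/
def cOp (L : ℕ) (l : Fin L) : Module.End ℂ (W L) :=
  Finsupp.lift _ ℂ (Idx L) fun i =>
    Finsupp.single (i.1, Function.update i.2.1 l (i.2.1 l - 1), i.2.2.1, i.2.2.2)
      ((Real.sqrt (i.2.1 l) : ℝ) : ℂ)

/-- The cash creation operator c_l†. -/
def cdagOp (L : ℕ) (l : Fin L) : Module.End ℂ (W L) :=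
  Finsupp.lift _ ℂ (Idx L) fun i =>
    Finsupp.single (i.1, Function.update i.2.1 l (i.2.1 l + 1), i.2.2.1, i.2.2.2)
      ((Real.sqrt (i.2.1 l + 1) : ℝ) : ℂ)

/-- The supply annihilation operator o. -/
def oOp (L : ℕ) : Module.End ℂ (W L) :=
  Finsupp.lift _ ℂ (Idx L) fun i =>
    Finsupp.single (i.1, i.2.1, i.2.2.1 - 1, i.2.2.2) ((Real.sqrt i.2.2.1 : ℝ) : ℂ)

/-- The supply creation operator o†. -/
def odagOp (L : ℕ) : Module.End ℂ (W L) :=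
  Finsupp.lift _ ℂ (Idx L) fun i =>
    Finsupp.single (i.1, i.2.1, i.2.2.1 + 1, i.2.2.2) ((Real.sqrt (i.2.2.1 + 1) : ℝ) : ℂ)

/-- The price annihilation operator p. -/
def pOp (L : ℕ) : Module.End ℂ (W L) :=
  Finsupp.lift _ ℂ (Idx L) fun i =>
    Finsupp.single (i.1, i.2.1, i.2.2.1, i.2.2.2 - 1) ((Real.sqrt i.2.2.2 : ℝ) : ℂ)

/-- The price creation operator p†. -/
def pdagOp (L : ℕ) : Module.End ℂ (W L) :=
  Finsupp.lift _ ℂ (Idx L) fun i =>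
    Finsupp.single (i.1, i.2.1, i.2.2.1, i.2.2.2 + 1) ((Real.sqrt (i.2.2.2 + 1) : ℝ) : ℂ)

/-- The effective L-trader hamiltonian
H = Σ_l α_l a_l†a_l + Σ_l β_l c_l†c_l + o†o + p†p
  + Σ_{i,j} p_{ij}( a_i†a_j c_i^M (c_j†)^M + a_i a_j† (c_i†)^M c_j^M ) + (o†p + p†o). -/
def Ham (L : ℕ) (α β : Fin L → ℝ) (pc : Fin L → Fin L → ℝ) (M : ℕ) :
    Module.End ℂ (W L) :=
  (∑ l, ((α l : ℝ) : ℂ) • (adagOp L l * aOp L l))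
    + (∑ l, ((β l : ℝ) : ℂ) • (cdagOp L l * cOp L l))
    + odagOp L * oOp L + pdagOp L * pOp L
    + (∑ i, ∑ j, ((pc i j : ℝ) : ℂ) •
        (adagOp L i * aOp L j * (cOp L i) ^ M * (cdagOp L j) ^ M
          + aOp L i * adagOp L j * (cdagOp L i) ^ M * (cOp L j) ^ M))
    + (odagOp L * pOp L + pdagOp L * oOp L)

/-- The commutator [A,B] = AB − BA. -/
def opComm {L : ℕ} (A B : Module.End ℂ (W L)) : Module.End ℂ (W L) := A * B - B * A

/-- The diagonal operator with eigenvalue `d i` on the basis vector indexed by `i`. -/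
def diagOp {L : ℕ} (d : Idx L → ℂ) : Module.End ℂ (W L) :=
  Finsupp.lift _ ℂ (Idx L) fun i => Finsupp.single i (d i)

/-- `T` raises the eigenvalue of `N` by `s`: `[N, T] = s T`. -/
def HasCharge {L : ℕ} (N : Module.End ℂ (W L)) (s : ℂ) (T : Module.End ℂ (W L)) : Prop :=
  N * T = T * N + s • T

namespace HasCharge

variable {L : ℕ} {N S T : Module.End ℂ (W L)} {s t : ℂ}

theorem add (hS : HasCharge N s S) (hT : HasCharge N s T) : HasCharge N s (S + T) := by
  unfold HasCharge at *
  rw [mul_add, add_mul, hS, hT, smul_add]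
  abel

theorem smul (c : ℂ) (hT : HasCharge N s T) : HasCharge N s (c • T) := by
  unfold HasCharge at *
  rw [mul_smul_comm, hT, smul_mul_assoc, smul_add, smul_comm c s]

theorem zero : HasCharge N s 0 := by
  simp [HasCharge]

theorem sum {ι : Type*} (A : Finset ι) {F : ι → Module.End ℂ (W L)}
    (h : ∀ i, HasCharge N s (F i)) : HasCharge N s (∑ i ∈ A, F i) :=
  Finset.sum_induction F (HasCharge N s) (fun _ _ => add) zero fun i _ => h i

theorem mul (hS : HasCharge N s S) (hT : HasCharge N t T) : HasCharge N (s + t) (S * T) := by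
  unfold HasCharge at *
  rw [← mul_assoc, hS, add_mul, mul_assoc, hT, mul_add, mul_smul_comm, smul_mul_assoc, add_smul,
    mul_assoc]
  abel

theorem pow (hT : HasCharge N s T) (M : ℕ) : HasCharge N (M * s) (T ^ M) := by
  induction M with
  | zero => simp [HasCharge]
  | succ M ih =>
    rw [pow_succ]
    convert ih.mul hT using 1
    push_cast
    ring

theorem opComm_eq_zero (h : HasCharge N 0 T) : opComm T N = 0 := by
  unfold HasCharge at h
  rw [opComm, h, zero_smul, add_zero]
  exact sub_self (T * N)

/-- A weighted shift of the basis is charged if it changes the eigenvalue by a constant. -/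
theorem of_shift {d : Idx L → ℂ} {f : Idx L → Idx L} {w : Idx L → ℂ}
    (h : ∀ i, w i = 0 ∨ d (f i) = d i + s) :
    HasCharge (diagOp d) s (Finsupp.lift _ ℂ (Idx L) fun i => Finsupp.single (f i) (w i)) := by
  unfold HasCharge
  refine Finsupp.lhom_ext' fun i => LinearMap.ext_ring ?_
  rcases h i with h | h
  · simp [-Finsupp.single_mul, diagOp, h]
  · simp [-Finsupp.single_mul, diagOp, h, ← Finsupp.single_add]
    congr 1
    ring

end HasCharge

section Number

variable (L : ℕ)

theorem sqrt_mul_sqrt_natCast (n : ℕ) :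
    ((Real.sqrt n : ℝ) : ℂ) * ((Real.sqrt n : ℝ) : ℂ) = n := by
  rw [← Complex.ofReal_mul, Real.mul_self_sqrt n.cast_nonneg, Complex.ofReal_natCast]

theorem adagOp_mul_aOp (l : Fin L) : adagOp L l * aOp L l = diagOp fun i => (i.1 l : ℂ) := by
  refine Finsupp.lhom_ext' fun i => LinearMap.ext_ring ?_
  rcases Nat.eq_zero_or_pos (i.1 l) with h | h
  · simp [-Finsupp.single_mul, aOp, adagOp, diagOp, h]
  · have e : ((i.1 l - 1 : ℕ) : ℝ) + 1 = i.1 l := by exact_mod_cast Nat.sub_add_cancel h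
    simp [-Finsupp.single_mul, aOp, adagOp, diagOp, e, sqrt_mul_sqrt_natCast, Nat.sub_add_cancel h]

theorem cdagOp_mul_cOp (l : Fin L) :
    cdagOp L l * cOp L l = diagOp fun i => (i.2.1 l : ℂ) := by
  refine Finsupp.lhom_ext' fun i => LinearMap.ext_ring ?_
  rcases Nat.eq_zero_or_pos (i.2.1 l) with h | h
  · simp [-Finsupp.single_mul, cOp, cdagOp, diagOp, h]
  · have e : ((i.2.1 l - 1 : ℕ) : ℝ) + 1 = i.2.1 l := by exact_mod_cast Nat.sub_add_cancel h
    simp [-Finsupp.single_mul, cOp, cdagOp, diagOp, e, sqrt_mul_sqrt_natCast, Nat.sub_add_cancel h]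

theorem odagOp_mul_oOp : odagOp L * oOp L = diagOp fun i => (i.2.2.1 : ℂ) := by
  refine Finsupp.lhom_ext' fun i => LinearMap.ext_ring ?_
  rcases Nat.eq_zero_or_pos i.2.2.1 with h | h
  · simp [-Finsupp.single_mul, oOp, odagOp, diagOp, h]
  · have e : ((i.2.2.1 - 1 : ℕ) : ℝ) + 1 = i.2.2.1 := by exact_mod_cast Nat.sub_add_cancel h
    simp [-Finsupp.single_mul, oOp, odagOp, diagOp, e, sqrt_mul_sqrt_natCast, Nat.sub_add_cancel h]

theorem pdagOp_mul_pOp : pdagOp L * pOp L = diagOp fun i => (i.2.2.2 : ℂ) := by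
  refine Finsupp.lhom_ext' fun i => LinearMap.ext_ring ?_
  rcases Nat.eq_zero_or_pos i.2.2.2 with h | h
  · simp [-Finsupp.single_mul, pOp, pdagOp, diagOp, h]
  · have e : ((i.2.2.2 - 1 : ℕ) : ℝ) + 1 = i.2.2.2 := by exact_mod_cast Nat.sub_add_cancel h
    simp [-Finsupp.single_mul, pOp, pdagOp, diagOp, e, sqrt_mul_sqrt_natCast, Nat.sub_add_cancel h]

theorem diagOp_add (d e : Idx L → ℂ) : diagOp d + diagOp e = diagOp fun i => d i + e i := by
  refine Finsupp.lhom_ext' fun i => LinearMap.ext_ring ?_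
  simp [-Finsupp.single_mul, diagOp]

theorem sum_diagOp {ι : Type*} (A : Finset ι) (d : ι → Idx L → ℂ) :
    ∑ l ∈ A, diagOp (d l) = diagOp fun i => ∑ l ∈ A, d l i := by
  refine Finsupp.lhom_ext' fun i => LinearMap.ext_ring ?_
  simp [-Finsupp.single_mul, diagOp, Finsupp.single_finsetSum]

end Number

theorem sum_update_succ {ι : Type*} [Fintype ι] [DecidableEq ι] (n : ι → ℕ) (l : ι) :
    ∑ j, (Function.update n l (n l + 1) j : ℂ) = ∑ j, (n j : ℂ) + 1 := by
  rw [← Finset.add_sum_erase _ _ (Finset.mem_univ l),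
    ← Finset.add_sum_erase _ (fun j => (n j : ℂ)) (Finset.mem_univ l),
    Finset.sum_congr rfl fun j hj => by rw [Function.update_of_ne (Finset.ne_of_mem_erase hj)]]
  rw [Function.update_self]
  push_cast
  ring

theorem sum_update_pred {ι : Type*} [Fintype ι] [DecidableEq ι] (n : ι → ℕ) (l : ι)
    (h : n l ≠ 0) :
    ∑ j, (Function.update n l (n l - 1) j : ℂ) = ∑ j, (n j : ℂ) + -1 := by
  have e := sum_update_succ (Function.update n l (n l - 1)) l
  rw [Function.update_self, Nat.sub_add_cancel (Nat.pos_of_ne_zero h), Function.update_idem,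
    Function.update_eq_self] at e
  rw [e]
  ring

/-- If share, cash, and supply/price ladder operators carry charges `∓a`, `∓c`, `∓o`, then the
hamiltonian is neutral. -/
theorem HasCharge.ham {L : ℕ} {N : Module.End ℂ (W L)} {a c o : ℂ}
    (ha : ∀ l, HasCharge N (-a) (aOp L l)) (ha' : ∀ l, HasCharge N a (adagOp L l))
    (hc : ∀ l, HasCharge N (-c) (cOp L l)) (hc' : ∀ l, HasCharge N c (cdagOp L l))
    (ho : HasCharge N (-o) (oOp L)) (ho' : HasCharge N o (odagOp L))
    (hp : HasCharge N (-o) (pOp L)) (hp' : HasCharge N o (pdagOp L))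
    (α β : Fin L → ℝ) (pc : Fin L → Fin L → ℝ) (M : ℕ) :
    HasCharge N 0 (Ham L α β pc M) := by
  have neutral {s : ℂ} {T : Module.End ℂ (W L)} (h : HasCharge N s T) (hs : s = 0) :
      HasCharge N 0 T := hs ▸ h
  unfold Ham
  refine (((((HasCharge.sum _ fun l => ?_).add (HasCharge.sum _ fun l => ?_)).add ?_).add ?_).add
    (HasCharge.sum _ fun i => HasCharge.sum _ fun j => ?_)).add (.add ?_ ?_)
  · exact (neutral ((ha' l).mul (ha l)) (by ring)).smul _
  · exact (neutral ((hc' l).mul (hc l)) (by ring)).smul _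
  · exact neutral (ho'.mul ho) (by ring)
  · exact neutral (hp'.mul hp) (by ring)
  · refine (HasCharge.add ?_ ?_).smul _
    · exact neutral ((((ha' i).mul (ha j)).mul ((hc i).pow M)).mul ((hc' j).pow M)) (by ring)
    · exact neutral ((((ha i).mul (ha' j)).mul ((hc' i).pow M)).mul ((hc j).pow M)) (by ring)
  · exact neutral (ho'.mul hp) (by ring)
  · exact neutral (hp'.mul ho) (by ring)

theorem sqrt_natCast_eq_zero_or {n : ℕ} {P : Prop} (h : n ≠ 0 → P) :
    ((Real.sqrt n : ℝ) : ℂ) = 0 ∨ P := by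
  rcases eq_or_ne n 0 with rfl | hn
  · simp
  · exact .inr (h hn)

/-- the total number operator N̂ = Σ_l a_l†a_l, the total cash
operator K̂ = Σ_l c_l†c_l, and Γ̂ = o†o + p†p are integrals of motion:
[H, N̂] = [H, K̂] = [H, Γ̂] = 0. -/
theorem integrals_of_motion (L : ℕ) (hL : 1 ≤ L) (α β : Fin L → ℝ)
    (pc : Fin L → Fin L → ℝ) (hpc : ∀ i, pc i i = 0) (M : ℕ) (hM : 0 < M) :
    opComm (Ham L α β pc M) (∑ l, adagOp L l * aOp L l) = 0 ∧
    opComm (Ham L α β pc M) (∑ l, cdagOp L l * cOp L l) = 0 ∧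
    opComm (Ham L α β pc M) (odagOp L * oOp L + pdagOp L * pOp L) = 0 := by
  simp only [adagOp_mul_aOp, cdagOp_mul_cOp, odagOp_mul_oOp, pdagOp_mul_pOp, sum_diagOp,
    diagOp_add]
  refine ⟨(HasCharge.ham (a := 1) (c := 0) (o := 0) (fun l => .of_shift fun i => ?_)
      (fun l => .of_shift fun i => ?_) (fun l => .of_shift fun i => ?_)
      (fun l => .of_shift fun i => ?_) (.of_shift fun i => ?_) (.of_shift fun i => ?_)
      (.of_shift fun i => ?_) (.of_shift fun i => ?_) α β pc M).opComm_eq_zero,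
    (HasCharge.ham (a := 0) (c := 1) (o := 0) (fun l => .of_shift fun i => ?_)
      (fun l => .of_shift fun i => ?_) (fun l => .of_shift fun i => ?_)
      (fun l => .of_shift fun i => ?_) (.of_shift fun i => ?_) (.of_shift fun i => ?_)
      (.of_shift fun i => ?_) (.of_shift fun i => ?_) α β pc M).opComm_eq_zero,
    (HasCharge.ham (a := 0) (c := 0) (o := 1) (fun l => .of_shift fun i => ?_)
      (fun l => .of_shift fun i => ?_) (fun l => .of_shift fun i => ?_)
      (fun l => .of_shift fun i => ?_) (.of_shift fun i => ?_) (.of_shift fun i => ?_)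
      (.of_shift fun i => ?_) (.of_shift fun i => ?_) α β pc M).opComm_eq_zero⟩
  all_goals try (refine .inr ?_; simp only [neg_zero, add_zero]; done)
  · exact sqrt_natCast_eq_zero_or (sum_update_pred _ _)
  · exact .inr (sum_update_succ _ _)
  · exact sqrt_natCast_eq_zero_or (sum_update_pred _ _)
  · exact .inr (sum_update_succ _ _)
  · refine sqrt_natCast_eq_zero_or fun h => ?_
    simp only [Nat.cast_pred (Nat.pos_of_ne_zero h)]
    ring
  · refine .inr ?_
    push_cast
    ring
  · refine sqrt_natCast_eq_zero_or fun h => ?_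
    simp only [Nat.cast_pred (Nat.pos_of_ne_zero h)]
    ring
  · refine .inr ?_
    push_cast
    ring

end
end

section
/- For each j = 1,…,L, the operator M·a_j†a_j + c_j†c_j (which is M times the operator Q̂_j = a_j†a_j + (1/M)c_j†c_j) commutes with the effective L-trader hamiltonian H: [H, M·a_j†a_j + c_j†c_j] = 0, where [A,B] = AB − BA. -/
/- Context: the effective L-trader stock market. V is the free complex vector
space on basis vectors indexed by tuples (n_1,…,n_L; k_1,…,k_L; O; m) of
natural numbers, realized as finitely supported functions
((Fin L → ℕ) × (Fin L → ℕ) × ℕ × ℕ) →₀ ℂ. -/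

noncomputable section

/-- `T` raises the eigenvalues of `N` by `w`, that is, `[N, T] = w T`. -/
def HasWeight {A : Type*} [Ring A] [Algebra ℂ A] (N T : A) (w : ℂ) : Prop :=
  N * T - T * N = w • T

namespace HasWeight

variable {A : Type*} [Ring A] [Algebra ℂ A] {N S T : A} {v w : ℂ}

lemma add (hS : HasWeight N S w) (hT : HasWeight N T w) : HasWeight N (S + T) w := by
  unfold HasWeight at *
  rw [smul_add, ← hS, ← hT]
  noncomm_ring

lemma smul (c : ℂ) (hT : HasWeight N T w) : HasWeight N (c • T) w := by
  unfold HasWeight at *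
  rw [smul_comm, ← hT, mul_smul_comm, smul_mul_assoc, smul_sub]

lemma sum {ι : Type*} (s : Finset ι) {F : ι → A} (h : ∀ i ∈ s, HasWeight N (F i) w) :
    HasWeight N (∑ i ∈ s, F i) w := by
  unfold HasWeight at *
  rw [Finset.mul_sum, Finset.sum_mul, Finset.smul_sum, ← Finset.sum_sub_distrib]
  exact Finset.sum_congr rfl h

lemma mul (hS : HasWeight N S v) (hT : HasWeight N T w) : HasWeight N (S * T) (v + w) := by
  unfold HasWeight at *
  rw [add_smul, ← smul_mul_assoc, ← mul_smul_comm, ← hS, ← hT]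
  noncomm_ring

lemma pow (hT : HasWeight N T w) (n : ℕ) : HasWeight N (T ^ n) (n * w) := by
  induction n with
  | zero => simp [HasWeight]
  | succ n ih =>
    rw [pow_succ, Nat.cast_succ, add_mul, one_mul]
    exact ih.mul hT

end HasWeight

lemma lift_single_one {X V : Type*} [AddCommGroup V] [Module ℂ V] (f : X → V) (i : X) :
    Finsupp.lift V ℂ X f (Finsupp.single i 1) = f i := by
  simp [Finsupp.lift_apply]

/-- A weighted shift `φ_i ↦ s i φ_{f i}` has weight `w` with respect to a diagonal operator whose
eigenvalue goes up by `w` along every arrow `i ↦ f i` of nonzero coefficient. -/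
lemma hasWeight_lift_single {X : Type*} {N : Module.End ℂ (X →₀ ℂ)} {d : X → ℂ}
    (hN : ∀ i, N (Finsupp.single i 1) = d i • Finsupp.single i 1) {f : X → X} {s : X → ℂ} {w : ℂ}
    (h : ∀ i, s i ≠ 0 → d (f i) = d i + w) :
    HasWeight N (Finsupp.lift (X →₀ ℂ) ℂ X fun i => Finsupp.single (f i) (s i)) w := by
  unfold HasWeight
  ext1 i
  refine LinearMap.ext_ring ?_
  have hs : Finsupp.single (f i) (s i) = s i • Finsupp.single (f i) (1 : ℂ) := by simp
  simp only [LinearMap.comp_apply, Finsupp.lsingle_apply, LinearMap.sub_apply, Module.End.mul_apply,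
    LinearMap.smul_apply, hN, map_smul, lift_single_one]
  rw [hs, map_smul, hN]
  by_cases h0 : s i = 0
  · simp [h0]
  · rw [h i h0]
    module

lemma adagOp_mul_aOp_single (L : ℕ) (j : Fin L) (i : Idx L) :
    (adagOp L j * aOp L j) (Finsupp.single i 1) = (i.1 j : ℂ) • Finsupp.single i 1 := by
  obtain ⟨n, k, o, m⟩ := i
  rw [Module.End.mul_apply, aOp, lift_single_one, ← mul_one (Complex.ofReal _), ← smul_eq_mul,
    ← Finsupp.smul_single, map_smul, adagOp, lift_single_one]
  rcases Nat.eq_zero_or_pos (n j) with h | h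
  · simp [h]
  · simp [Nat.sub_add_cancel h, Nat.cast_sub (show 1 ≤ n j from h), ← Complex.ofReal_mul]

lemma cdagOp_mul_cOp_single (L : ℕ) (j : Fin L) (i : Idx L) :
    (cdagOp L j * cOp L j) (Finsupp.single i 1) = (i.2.1 j : ℂ) • Finsupp.single i 1 := by
  obtain ⟨n, k, o, m⟩ := i
  rw [Module.End.mul_apply, cOp, lift_single_one, ← mul_one (Complex.ofReal _), ← smul_eq_mul,
    ← Finsupp.smul_single, map_smul, cdagOp, lift_single_one]
  rcases Nat.eq_zero_or_pos (k j) with h | h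
  · simp [h]
  · simp [Nat.sub_add_cancel h, Nat.cast_sub (show 1 ≤ k j from h), ← Complex.ofReal_mul]

lemma cast_update_pred {L : ℕ} (n : Fin L → ℕ) (j l : Fin L) (h : n l ≠ 0) :
    (Function.update n l (n l - 1) j : ℂ) = n j - if l = j then 1 else 0 := by
  rcases eq_or_ne l j with rfl | hlj
  · simp [Nat.cast_sub (Nat.one_le_iff_ne_zero.mpr h)]
  · simp [hlj, hlj.symm]

lemma cast_update_succ {L : ℕ} (n : Fin L → ℕ) (j l : Fin L) :
    (Function.update n l (n l + 1) j : ℂ) = n j + if l = j then 1 else 0 := by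
  rcases eq_or_ne l j with rfl | hlj
  · simp
  · simp [hlj, hlj.symm]

/-- The operator `M a_j†a_j + c_j†c_j`. -/
def chargeOp (L M : ℕ) (j : Fin L) : Module.End ℂ (W L) :=
  (M : ℂ) • (adagOp L j * aOp L j) + cdagOp L j * cOp L j

lemma chargeOp_single (L M : ℕ) (j : Fin L) (i : Idx L) :
    chargeOp L M j (Finsupp.single i 1) = ((M : ℂ) * i.1 j + i.2.1 j) • Finsupp.single i 1 := by
  rw [chargeOp, LinearMap.add_apply, LinearMap.smul_apply, adagOp_mul_aOp_single,
    cdagOp_mul_cOp_single, add_smul, mul_smul]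

section weights

variable (L M : ℕ) (j l : Fin L)

lemma hasWeight_aOp : HasWeight (chargeOp L M j) (aOp L l) (-(M * if l = j then 1 else 0)) :=
  hasWeight_lift_single (chargeOp_single L M j) fun i hi => by
    have h : i.1 l ≠ 0 := fun h => hi (by simp [h])
    simp only [cast_update_pred i.1 j l h]
    ring

lemma hasWeight_adagOp : HasWeight (chargeOp L M j) (adagOp L l) (M * if l = j then 1 else 0) :=
  hasWeight_lift_single (chargeOp_single L M j) fun i _ => by
    simp only [cast_update_succ]
    ring

lemma hasWeight_cOp : HasWeight (chargeOp L M j) (cOp L l) (-if l = j then 1 else 0) :=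
  hasWeight_lift_single (chargeOp_single L M j) fun i hi => by
    have h : i.2.1 l ≠ 0 := fun h => hi (by simp [h])
    simp only [cast_update_pred i.2.1 j l h]
    ring

lemma hasWeight_cdagOp : HasWeight (chargeOp L M j) (cdagOp L l) (if l = j then 1 else 0) :=
  hasWeight_lift_single (chargeOp_single L M j) fun i _ => by
    simp only [cast_update_succ]
    ring

lemma hasWeight_oOp : HasWeight (chargeOp L M j) (oOp L) 0 :=
  hasWeight_lift_single (chargeOp_single L M j) fun _ _ => (add_zero _).symm

lemma hasWeight_odagOp : HasWeight (chargeOp L M j) (odagOp L) 0 :=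
  hasWeight_lift_single (chargeOp_single L M j) fun _ _ => (add_zero _).symm

lemma hasWeight_pOp : HasWeight (chargeOp L M j) (pOp L) 0 :=
  hasWeight_lift_single (chargeOp_single L M j) fun _ _ => (add_zero _).symm

lemma hasWeight_pdagOp : HasWeight (chargeOp L M j) (pdagOp L) 0 :=
  hasWeight_lift_single (chargeOp_single L M j) fun _ _ => (add_zero _).symm

lemma hasWeight_Ham (α β : Fin L → ℝ) (pc : Fin L → Fin L → ℝ) :
    HasWeight (chargeOp L M j) (Ham L α β pc M) 0 := by
  have ha := hasWeight_aOp L M j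
  have ha' := hasWeight_adagOp L M j
  have hc := hasWeight_cOp L M j
  have hc' := hasWeight_cdagOp L M j
  have ho := hasWeight_oOp L M j
  have ho' := hasWeight_odagOp L M j
  have hp := hasWeight_pOp L M j
  have hp' := hasWeight_pdagOp L M j
  refine .add (.add (.add (.add (.add ?_ ?_) ?_) ?_) ?_) (.add ?_ ?_)
  · refine .sum _ fun l _ => .smul _ ?_
    convert (ha' l).mul (ha l) using 1
    ring
  · refine .sum _ fun l _ => .smul _ ?_
    convert (hc' l).mul (hc l) using 1
    ring
  · simpa using ho'.mul ho
  · simpa using hp'.mul hp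
  · refine .sum _ fun i _ => .sum _ fun k _ => .smul _ (.add ?_ ?_)
    · convert (((ha' i).mul (ha k)).mul ((hc i).pow M)).mul ((hc' k).pow M) using 1
      ring
    · convert (((ha i).mul (ha' k)).mul ((hc' i).pow M)).mul ((hc k).pow M) using 1
      ring
  · simpa using ho'.mul hp
  · simpa using hp'.mul ho

end weights

/-- for each j, the operator M·a_j†a_j + c_j†c_j (which is M times
Q̂_j = a_j†a_j + (1/M)c_j†c_j) commutes with the effective L-trader hamiltonian:
[H, M·a_j†a_j + c_j†c_j] = 0. -/
theorem Qj_integral_of_motion (L : ℕ) (hL : 1 ≤ L) (α β : Fin L → ℝ)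
    (pc : Fin L → Fin L → ℝ) (hpc : ∀ i, pc i i = 0) (M : ℕ) (hM : 0 < M) :
    ∀ j : Fin L,
      opComm (Ham L α β pc M) ((M : ℂ) • (adagOp L j * aOp L j) + cdagOp L j * cOp L j)
        = 0 := by
  intro j
  have h := hasWeight_Ham L M j α β pc
  rw [HasWeight, zero_smul, sub_eq_zero] at h
  exact sub_eq_zero.mpr h.symm

end
end
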